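/- arXiv:0708.2336 — 2 statements merged into one kernel-verified Lean document; each statement's English description precedes it below -/
import Mathlib

section
/- For every natural number k ≥ 1 and every real δ > 0, there exists a linear k-CNF formula F such that for every assignment α, the number of clauses of F not satisfied by α is at least (1-δ)·2^{-k}·|F|. -/
/-- A clause: a finite set of literals, where a literal is a pair of a variable
and a sign (`true` = positive occurrence, `false` = negated occurrence). -/
abbrev Clause (V : Type) : Type := Finset (V × Bool)

/-- A CNF formula: a finite set of clauses. -/
abbrev CNF (V : Type) : Type := Finset (Finset (V × Bool))

/-- The set of variables occurring (possibly negated) in a clause. -/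
def vbl {V : Type} [DecidableEq V] (C : Clause V) : Finset V := C.image Prod.fst

/-- A clause is proper if it does not contain both a variable and its negation. -/
def ProperClause {V : Type} (C : Clause V) : Prop :=
  ∀ x : V, ¬ ((x, true) ∈ C ∧ (x, false) ∈ C)

/-- The literal `(x, b)` evaluates to true under `α` iff `α x = b`;
an assignment satisfies a clause if some literal evaluates to true. -/
def SatClause {V : Type} (α : V → Bool) (C : Clause V) : Prop :=
  ∃ l ∈ C, α l.1 = l.2

instance {V : Type} [DecidableEq V] (α : V → Bool) (C : Clause V) :
    Decidable (SatClause α C) := by unfold SatClause; infer_instance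

/-- An assignment satisfies a formula if it satisfies every clause. -/
def Satisfies {V : Type} (α : V → Bool) (F : CNF V) : Prop :=
  ∀ C ∈ F, SatClause α C

/-- A formula is unsatisfiable if no assignment satisfies it. -/
def Unsat {V : Type} (F : CNF V) : Prop := ∀ α : V → Bool, ¬ Satisfies α F

/-- A `k`-CNF: every clause is proper and has exactly `k` literals. -/
def IsKCNF {V : Type} (k : ℕ) (F : CNF V) : Prop :=
  ∀ C ∈ F, ProperClause C ∧ C.card = k

/-- A CNF is linear if any two distinct clauses share at most one variable. -/
def LinearCNF {V : Type} [DecidableEq V] (F : CNF V) : Prop :=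
  ∀ C ∈ F, ∀ D ∈ F, C ≠ D → (vbl C ∩ vbl D).card ≤ 1

open Finset in
/-- Some function `s` agrees with each of the given functions `t a` almost as often as a random
function does on average, provided the family `t` is not too large. -/
theorem exists_forall_le_card_agree {A E S : Type*} [Fintype A] [Fintype E] [Fintype S]
    [DecidableEq S] [Nonempty S] (t : A → E → S) {δ : ℝ} (hδ : 0 < δ) (hδ1 : δ ≤ 1)
    (h : (Fintype.card A : ℝ) <
      Real.exp (Fintype.card E / Fintype.card S * (δ ^ 2 / 4))) :
    ∃ s : E → S, ∀ a, (1 - δ) * (Fintype.card E / Fintype.card S) ≤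
      (#{e | s e = t a e} : ℝ) := by
  classical
  by_contra! hcon
  set m : ℝ := Fintype.card E / Fintype.card S with hm
  have hm0 : 0 ≤ m := by positivity
  have hS : (0 : ℝ) < Fintype.card S := by exact_mod_cast Fintype.card_pos
  let w : ℝ := Real.exp (-(δ / 2))
  have hw : 1 - w - δ / 2 * (1 - δ) ≥ δ ^ 2 / 4 := by
    have := (abs_le.1 (Real.abs_exp_sub_one_sub_id_le (x := -(δ / 2))
      (by rw [abs_neg, abs_of_pos (by positivity)]; linarith))).2
    simp only [w]
    nlinarith
  have lower : (Fintype.card S : ℝ) ^ Fintype.card E * Real.exp (-(δ / 2) * ((1 - δ) * m)) ≤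
      ∑ s : E → S, ∑ a, w ^ #{e | s e = t a e} := by
    have : (Fintype.card S : ℝ) ^ Fintype.card E * Real.exp (-(δ / 2) * ((1 - δ) * m)) =
        ∑ _s : E → S, Real.exp (-(δ / 2) * ((1 - δ) * m)) := by simp
    rw [this]
    refine sum_le_sum fun s _ => ?_
    obtain ⟨a, ha⟩ := hcon s
    refine le_trans ?_ (single_le_sum (f := fun a => w ^ #{e | s e = t a e})
      (fun _ _ => by positivity) (mem_univ a))
    simp only [w]
    rw [← Real.exp_nat_mul, Real.exp_le_exp]
    nlinarith
  have column (a : A) : ∑ s : E → S, w ^ #{e | s e = t a e} ≤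
      (Fintype.card S : ℝ) ^ Fintype.card E * Real.exp (-((1 - w) * m)) := by
    have hfac (e : E) : ∑ c : S, (if c = t a e then w else 1) = Fintype.card S - (1 - w) := by
      have (c : S) : (if c = t a e then w else 1) = 1 - if c = t a e then 1 - w else 0 := by
        split_ifs <;> ring
      simp [this]
    have hprod : ∑ s : E → S, w ^ #{e | s e = t a e} =
        (Fintype.card S - (1 - w)) ^ Fintype.card E := by
      calc _ = ∑ s : E → S, ∏ e, (if s e = t a e then w else 1) := by
            simp [prod_ite]
        _ = ∏ e, ∑ c : S, (if c = t a e then w else 1) := by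
            rw [prod_univ_sum, Fintype.piFinset_univ]
        _ = _ := by simp [hfac]
    have hone : (1 : ℝ) ≤ Fintype.card S := by exact_mod_cast Fintype.card_pos (α := S)
    have hw0 : 0 < w := Real.exp_pos _
    have hexp : -((1 - w) * m) = Fintype.card E * (-((1 - w) / Fintype.card S)) := by
      rw [hm]; ring
    rw [hprod, hexp, Real.exp_nat_mul, ← mul_pow]
    refine pow_le_pow_left₀ (by linarith) ?_ _
    have := mul_le_mul_of_nonneg_left
      (Real.add_one_le_exp (-((1 - w) / Fintype.card S))) hS.le
    refine le_trans (le_of_eq ?_) this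
    field_simp
    ring
  have upper : ∑ s : E → S, ∑ a, w ^ #{e | s e = t a e} ≤
      Fintype.card A * ((Fintype.card S : ℝ) ^ Fintype.card E * Real.exp (-((1 - w) * m))) := by
    rw [sum_comm]
    simpa using sum_le_sum fun a (_ : a ∈ univ) => column a
  have key : (Fintype.card A : ℝ) * Real.exp (-((1 - w) * m)) <
      Real.exp (-(δ / 2) * ((1 - δ) * m)) :=
    calc _ < Real.exp (m * (δ ^ 2 / 4)) * Real.exp (-((1 - w) * m)) :=
          mul_lt_mul_of_pos_right h (Real.exp_pos _)
      _ ≤ _ := by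
          rw [← Real.exp_add, Real.exp_le_exp]
          nlinarith
  have := mul_lt_mul_of_pos_left key (pow_pos hS (Fintype.card E))
  linarith

/-- The variable coding the point with abscissa `i` on the line `y = e.1 * x + e.2` over
`ZMod p`. -/
def lineVar {k : ℕ} (p : ℕ) (e : ZMod p × ZMod p) (i : Fin k) : ℕ :=
  Nat.pair i (e.1 * (i : ℕ) + e.2).val

theorem lineVar_eq_iff {k p : ℕ} [NeZero p] {e e' : ZMod p × ZMod p} {i j : Fin k} :
    lineVar p e i = lineVar p e' j ↔
      i = j ∧ e.1 * (i : ℕ) + e.2 = e'.1 * (j : ℕ) + e'.2 := by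
  rw [lineVar, lineVar, Nat.pair_eq_pair, Fin.val_inj, (ZMod.val_injective p).eq_iff]

/-- Distinct lines meet in at most one point. -/
theorem eq_of_lineVar_eq {k p : ℕ} [Fact p.Prime] (hkp : k ≤ p) {e e' : ZMod p × ZMod p}
    (he : e ≠ e') {i i' j j' : Fin k} (hi : lineVar p e i = lineVar p e' i')
    (hj : lineVar p e j = lineVar p e' j') : i = j := by
  obtain ⟨rfl, hi⟩ := lineVar_eq_iff.1 hi
  obtain ⟨rfl, hj⟩ := lineVar_eq_iff.1 hj
  have hmul : (e.1 - e'.1) * ((i : ℕ) - (j : ℕ) : ZMod p) = 0 := by linear_combination hi - hj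
  rcases mul_eq_zero.1 hmul with h | h
  · refine absurd (Prod.ext (sub_eq_zero.1 h) ?_) he
    linear_combination hi - (i : ℕ) * h
  · have h' := congrArg ZMod.val (sub_eq_zero.1 h)
    rw [ZMod.val_cast_of_lt (i.2.trans_le hkp), ZMod.val_cast_of_lt (j.2.trans_le hkp)] at h'
    exact Fin.ext h'

/-- The clause on the points of a line, with signs `s`. -/
def lineClause {k : ℕ} (p : ℕ) (e : ZMod p × ZMod p) (s : Fin k → Bool) : Clause ℕ :=
  Finset.univ.image fun i => (lineVar p e i, s i)

theorem mem_lineClause {k p : ℕ} {e : ZMod p × ZMod p} {s : Fin k → Bool} {l : ℕ × Bool} :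
    l ∈ lineClause p e s ↔ ∃ i, (lineVar p e i, s i) = l := by
  simp [lineClause]

theorem mem_vbl_lineClause {k p : ℕ} {e : ZMod p × ZMod p} {s : Fin k → Bool} {x : ℕ} :
    x ∈ vbl (lineClause p e s) ↔ ∃ i : Fin k, lineVar p e i = x := by
  simp [vbl, lineClause]

theorem lineVar_injective {k p : ℕ} [NeZero p] (e : ZMod p × ZMod p) :
    Function.Injective (lineVar p e : Fin k → ℕ) :=
  fun _ _ h => (lineVar_eq_iff.1 h).1

theorem properClause_lineClause {k p : ℕ} [NeZero p] (e : ZMod p × ZMod p) (s : Fin k → Bool) :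
    ProperClause (lineClause p e s) := by
  rintro x ⟨h₁, h₂⟩
  obtain ⟨i, hi⟩ := mem_lineClause.1 h₁
  obtain ⟨j, hj⟩ := mem_lineClause.1 h₂
  rw [Prod.mk.injEq] at hi hj
  obtain rfl := lineVar_injective e (hi.1.trans hj.1.symm)
  exact Bool.noConfusion (hi.2.symm.trans hj.2)

theorem card_lineClause {k p : ℕ} [NeZero p] (e : ZMod p × ZMod p) (s : Fin k → Bool) :
    (lineClause p e s).card = k := by
  rw [lineClause, Finset.card_image_of_injective _ fun i j h =>
    lineVar_injective e (Prod.ext_iff.1 h).1, Finset.card_fin]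

theorem card_vbl_lineClause_inter_le {k p : ℕ} [Fact p.Prime] (hkp : k ≤ p)
    {e e' : ZMod p × ZMod p} (he : e ≠ e') (s s' : Fin k → Bool) :
    (vbl (lineClause p e s) ∩ vbl (lineClause p e' s')).card ≤ 1 := by
  refine Finset.card_le_one.2 fun x hx y hy => ?_
  rw [Finset.mem_inter, mem_vbl_lineClause, mem_vbl_lineClause] at hx hy
  obtain ⟨⟨i, rfl⟩, i', hi⟩ := hx
  obtain ⟨⟨j, rfl⟩, j', hj⟩ := hy
  rw [eq_of_lineVar_eq hkp he hi.symm hj.symm]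

theorem lineClause_injective {k p : ℕ} [Fact p.Prime] (hk : 2 ≤ k) (hkp : k ≤ p)
    (s : ZMod p × ZMod p → Fin k → Bool) :
    Function.Injective fun e => lineClause p e (s e) := by
  intro e e' h
  by_contra he
  have hv : ∀ i : Fin k, ∃ i' : Fin k, lineVar p e' i' = lineVar p e i := fun i => by
    rw [← mem_vbl_lineClause (s := s e'), ← show lineClause p e (s e) = lineClause p e' (s e')
      from h, mem_vbl_lineClause]
    exact ⟨i, rfl⟩
  obtain ⟨i', hi⟩ := hv ⟨0, by omega⟩
  obtain ⟨j', hj⟩ := hv ⟨1, by omega⟩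
  simpa using eq_of_lineVar_eq hkp he hi.symm hj.symm

theorem not_satClause_lineClause {k p : ℕ} {e : ZMod p × ZMod p} {s : Fin k → Bool}
    {α : ℕ → Bool} : ¬ SatClause α (lineClause p e s) ↔ s = fun i => !α (lineVar p e i) := by
  simp only [SatClause, lineClause, Finset.mem_image, Finset.mem_univ, true_and, funext_iff]
  push Not
  constructor
  · exact fun h i => Bool.eq_not.2 (h _ ⟨i, rfl⟩).symm
  · rintro h _ ⟨i, rfl⟩
    simp [h i]

/-- A nonempty linear `k`-CNF, for `k ≥ 2`, every assignment of which leaves almost a `2⁻ᵏ`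
fraction of the clauses unsatisfied. -/
theorem exists_nonempty_linear_kCNF_of_two_le {k : ℕ} (hk : 2 ≤ k) {δ : ℝ} (hδ : 0 < δ)
    (hδ1 : δ ≤ 1) :
    ∃ F : CNF ℕ, F.Nonempty ∧ IsKCNF k F ∧ LinearCNF F ∧
      ∀ α : ℕ → Bool,
        (1 - δ) * (2 : ℝ) ^ (-(k : ℤ)) * F.card ≤
          ((F.filter fun C => ¬ SatClause α C).card : ℝ) := by
  obtain ⟨p, hp, hprime⟩ := Nat.exists_infinite_primes (k + (⌊4 * k * 2 ^ k / δ ^ 2⌋₊ + 1))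
  have : Fact p.Prime := ⟨hprime⟩
  have hkp : k ≤ p := by omega
  have hp0 : (0 : ℝ) < p := by exact_mod_cast hprime.pos
  have hlarge : 4 * k * 2 ^ k / δ ^ 2 < (p : ℝ) :=
    (Nat.lt_floor_add_one _).trans_le (by exact_mod_cast (Nat.le_add_left _ _).trans hp)
  obtain ⟨s, hs⟩ := exists_forall_le_card_agree
    (A := Fin k × ZMod p → Bool) (E := ZMod p × ZMod p) (S := Fin k → Bool)
    (fun a e i => !a (i, e.1 * (i : ℕ) + e.2)) hδ hδ1 (by
      simp only [Fintype.card_fun, Fintype.card_prod, Fintype.card_fin, Fintype.card_bool,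
        ZMod.card]
      push_cast
      have h2 : (2 : ℝ) ≤ Real.exp 1 := by linarith [Real.add_one_le_exp (1 : ℝ)]
      refine (pow_le_pow_left₀ zero_le_two h2 _).trans_lt ?_
      rw [← Real.exp_nat_mul, Real.exp_lt_exp, mul_one]
      push_cast
      rw [div_lt_iff₀ (by positivity)] at hlarge
      rw [div_mul_eq_mul_div, lt_div_iff₀ (by positivity)]
      nlinarith)
  have hinj := lineClause_injective hk hkp s
  refine ⟨Finset.univ.image fun e => lineClause p e (s e), by simp, ?_, ?_, fun α => ?_⟩
  · intro C hC
    obtain ⟨e, -, rfl⟩ := Finset.mem_image.1 hC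
    exact ⟨properClause_lineClause e _, card_lineClause e _⟩
  · intro C hC D hD hCD
    obtain ⟨e, -, rfl⟩ := Finset.mem_image.1 hC
    obtain ⟨e', -, rfl⟩ := Finset.mem_image.1 hD
    exact card_vbl_lineClause_inter_le hkp (fun h => hCD (by rw [h])) _ _
  · rw [Finset.filter_image, Finset.card_image_of_injective _ hinj,
      Finset.card_image_of_injective _ hinj]
    simp only [not_satClause_lineClause]
    have := hs fun x => α (Nat.pair x.1 x.2.val)
    rw [Fintype.card_fun, Fintype.card_fin, Fintype.card_bool] at this
    push_cast at this
    rw [Finset.card_univ, zpow_neg, zpow_natCast, mul_assoc, inv_mul_eq_div]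
    exact this

theorem exists_nonempty_linear_oneCNF :
    ∃ F : CNF ℕ, F.Nonempty ∧ IsKCNF 1 F ∧ LinearCNF F ∧
      ∀ α : ℕ → Bool, F.card = 2 * (F.filter fun C => ¬ SatClause α C).card := by
  refine ⟨{{(0, true)}, {(0, false)}}, by simp, by simp [IsKCNF, ProperClause], ?_, fun α => ?_⟩
  · simp [LinearCNF, vbl]
  · rw [Finset.filter_insert, Finset.filter_singleton]
    cases h : α 0 <;> simp [SatClause, h]

/-- The formula in `linear_kCNF_partial_sat_lower` can be taken nonempty. -/
theorem exists_nonempty_linear_kCNF {k : ℕ} (hk : 1 ≤ k) {δ : ℝ} (hδ : 0 < δ) :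
    ∃ F : CNF ℕ, F.Nonempty ∧ IsKCNF k F ∧ LinearCNF F ∧
      ∀ α : ℕ → Bool,
        (1 - δ) * (2 : ℝ) ^ (-(k : ℤ)) * F.card ≤
          ((F.filter fun C => ¬ SatClause α C).card : ℝ) := by
  rcases hk.eq_or_lt with rfl | hk
  · obtain ⟨F, hne, hF, hlin, h⟩ := exists_nonempty_linear_oneCNF
    refine ⟨F, hne, hF, hlin, fun α => ?_⟩
    rw [h α]
    push_cast
    rw [zpow_neg_one]
    nlinarith [mul_nonneg hδ.le (Nat.cast_nonneg (α := ℝ)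
      (F.filter fun C => ¬ SatClause α C).card)]
  · obtain ⟨F, hne, hF, hlin, h⟩ :=
      exists_nonempty_linear_kCNF_of_two_le hk (lt_min hδ one_pos) (min_le_right δ 1)
    refine ⟨F, hne, hF, hlin, fun α => le_trans ?_ (h α)⟩
    gcongr
    exact min_le_left δ 1

/-- For every `k ≥ 1` and every real `δ > 0`, there is a linear
`k`-CNF formula `F` such that every assignment leaves at least `(1-δ)·2^{-k}·|F|`
clauses of `F` unsatisfied. -/
theorem linear_kCNF_partial_sat_lower (k : ℕ) (hk : 1 ≤ k) (δ : ℝ) (hδ : 0 < δ) :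
    ∃ F : CNF ℕ, IsKCNF k F ∧ LinearCNF F ∧
      ∀ α : ℕ → Bool,
        (1 - δ) * (2 : ℝ) ^ (-(k : ℤ)) * F.card ≤
          ((F.filter fun C => ¬ SatClause α C).card : ℝ) := by
  obtain ⟨F, -, hF⟩ := exists_nonempty_linear_kCNF hk hδ
  exact ⟨F, hF⟩
end

section
/- Fix k and let F be an unsatisfiable [l,k]-CNF formula with 2 ≤ l ≤ k. Then F contains a clause C with |Γ(C)| > 2^{k-2} - k·d(F)·2^{k-l}. -/
/-- The neighborhood `Γ(C)` of a clause `C` in `F`: the clauses of `F` other than `C`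
sharing at least one variable with `C`. -/
def Gamma {V : Type} [DecidableEq V] (F : CNF V) (C : Clause V) : Finset (Clause V) :=
  F.filter fun D => D ≠ C ∧ (vbl D ∩ vbl C).Nonempty

/-- `Γ'(C)`: the neighbors of `C` of size at most `k - 1`. -/
def Gamma' {V : Type} [DecidableEq V] (k : ℕ) (F : CNF V) (C : Clause V) :
    Finset (Clause V) :=
  (Gamma F C).filter fun D => D.card ≤ k - 1

/-- `d_F(x)`: the number of clauses of `F` of size at most `k - 1` containing the
variable `x`. -/
def degVar {V : Type} [DecidableEq V] (k : ℕ) (F : CNF V) (x : V) : ℕ :=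
  (F.filter fun C => x ∈ vbl C ∧ C.card ≤ k - 1).card

/-- `d(F)`: the maximum of `d_F(x)` over all variables `x` of `F`. -/
def degCNF {V : Type} [DecidableEq V] (k : ℕ) (F : CNF V) : ℕ :=
  (F.biUnion vbl).sup (degVar k F)

open Finset in
/-- The truth assignments on the variables `W`, encoded by their sets of true variables, that
satisfy the formula `S`. -/
def satSets {V : Type} [DecidableEq V] (W : Finset V) (S : CNF V) : Finset (Finset V) :=
  {A ∈ W.powerset | ∀ D ∈ S, SatClause (fun v => decide (v ∈ A)) D}

open Finset in
/-- The members of `satSets W S` that violate the clause `C`. -/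
def violSets {V : Type} [DecidableEq V] (W : Finset V) (S : CNF V) (C : Clause V) :
    Finset (Finset V) :=
  {A ∈ satSets W S | ¬ SatClause (fun v => decide (v ∈ A)) C}

section LocalLemma

variable {V : Type} [DecidableEq V]

theorem satSets_anti (W : Finset V) {S T : CNF V} (h : S ⊆ T) : satSets W T ⊆ satSets W S := by
  intro A hA
  simp only [satSets, Finset.mem_filter] at hA ⊢
  exact ⟨hA.1, fun D hD => hA.2 D (h hD)⟩

theorem violSets_anti (W : Finset V) {S T : CNF V} (h : S ⊆ T) (C : Clause V) :
    violSets W T C ⊆ violSets W S C :=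
  Finset.filter_subset_filter _ (satSets_anti W h)

theorem ProperClause.card_vbl {C : Clause V} (h : ProperClause C) : (vbl C).card = C.card := by
  refine Finset.card_image_of_injOn ?_
  rintro ⟨x, a⟩ ha ⟨y, b⟩ hb (rfl : x = y)
  have := h x
  cases a <;> cases b <;> simp_all

/-- Independence: violating `C` costs a factor `2 ^ |vbl C|` among the assignments that satisfy
clauses not sharing a variable with `C`. -/
theorem two_pow_mul_card_violSets_le (W : Finset V) (S : CNF V) (C : Clause V)
    (hCW : vbl C ⊆ W) (hS : ∀ D ∈ S, Disjoint (vbl D) (vbl C)) :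
    2 ^ (vbl C).card * (violSets W S C).card ≤ (satSets W S).card := by
  rw [← Finset.card_powerset, ← Finset.card_product]
  refine Finset.card_le_card_of_injOn (fun p => symmDiff p.2 p.1) ?_ ?_
  · rintro ⟨T, A⟩ h
    simp only [Finset.coe_product, Set.mem_prod, Finset.mem_coe, Finset.mem_powerset, violSets,
      satSets, Finset.mem_filter] at h ⊢
    obtain ⟨hT, ⟨hA, hsat⟩, -⟩ := h
    refine ⟨fun v hv => ?_, fun D hD => ?_⟩
    · rcases Finset.mem_symmDiff.1 hv with h | h
      · exact hA h.1
      · exact hCW (hT h.1)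
    · obtain ⟨m, hm, hv⟩ := hsat D hD
      have hmT : m.1 ∉ T := fun h =>
        Finset.disjoint_left.1 (hS D hD) (Finset.mem_image_of_mem _ hm) (hT h)
      exact ⟨m, hm, by simpa [Finset.mem_symmDiff, hmT] using hv⟩
  · rintro ⟨T, A⟩ h ⟨T', A'⟩ h' heq
    simp only [Finset.coe_product, Set.mem_prod, Finset.mem_coe, Finset.mem_powerset, violSets,
      Finset.mem_filter] at h h' heq
    have hAA : ∀ v ∈ vbl C, (v ∈ A ↔ v ∈ A') := by
      intro v hv
      obtain ⟨m, hm, rfl⟩ := Finset.mem_image.1 hv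
      have h1 : decide (m.1 ∈ A) ≠ m.2 := fun e => h.2.2 ⟨m, hm, e⟩
      have h2 : decide (m.1 ∈ A') ≠ m.2 := fun e => h'.2.2 ⟨m, hm, e⟩
      cases hb : m.2 <;> simp_all
    have hmem : ∀ v, (v ∈ A ↔ v ∈ A') ∧ (v ∈ T ↔ v ∈ T') := by
      intro v
      have hv := Finset.ext_iff.1 heq v
      simp only [Finset.mem_symmDiff] at hv
      have h1 := @h.1 v
      have h2 := @h'.1 v
      have h3 := hAA v
      tauto
    exact Prod.ext (Finset.ext fun v => (hmem v).2) (Finset.ext fun v => (hmem v).1)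

theorem card_satSets_le (W : Finset V) (S R : CNF V) :
    (satSets W S).card ≤ (satSets W (S ∪ R)).card + ∑ D ∈ R, (violSets W S D).card := by
  have hsub : satSets W S ⊆ satSets W (S ∪ R) ∪ R.biUnion (violSets W S) := by
    intro A hA
    by_cases h : ∀ D ∈ R, SatClause (fun v => decide (v ∈ A)) D
    · refine Finset.mem_union_left _ ?_
      simp only [satSets, Finset.mem_filter] at hA ⊢
      exact ⟨hA.1, fun D hD => (Finset.mem_union.1 hD).elim (hA.2 D) (h D)⟩
    · push Not at h
      obtain ⟨D, hD, hviol⟩ := h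
      exact Finset.mem_union_right _
        (Finset.mem_biUnion.2 ⟨D, hD, Finset.mem_filter.2 ⟨hA, hviol⟩⟩)
  calc (satSets W S).card ≤ _ := Finset.card_le_card hsub
    _ ≤ _ := Finset.card_union_le _ _
    _ ≤ _ := Nat.add_le_add_left Finset.card_biUnion_le _

/-- The conditional probability bound in the proof of the local lemma. -/
theorem card_violSets_le (F : CNF V) (hproper : ∀ C ∈ F, ProperClause C)
    (hsum : ∀ C ∈ F, ∑ D ∈ Gamma F C, (1 / 2 : ℝ) ^ D.card ≤ 1 / 4)
    (S : CNF V) (hS : S ⊆ F) (C : Clause V) (hC : C ∈ F) (hCS : C ∉ S) :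
    ((violSets (F.biUnion vbl) S C).card : ℝ) ≤
      2 * (1 / 2) ^ C.card * (satSets (F.biUnion vbl) S).card := by
  induction S using Finset.strongInduction generalizing C with
  | H S ih =>
    set W := F.biUnion vbl
    set R := S ∩ Gamma F C
    set T := S \ Gamma F C
    have hTS : T ⊆ S := Finset.sdiff_subset
    have hindep : (2 : ℝ) ^ C.card * (violSets W T C).card ≤ (satSets W T).card := by
      have h := two_pow_mul_card_violSets_le W T C (Finset.subset_biUnion_of_mem vbl hC) ?_
      · rw [(hproper C hC).card_vbl] at h
        exact_mod_cast h
      · intro D hD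
        obtain ⟨hDS, hDG⟩ := Finset.mem_sdiff.1 hD
        by_contra hdis
        refine hDG (Finset.mem_filter.2 ⟨hS hDS, ?_, Finset.not_disjoint_iff_nonempty_inter.1 hdis⟩)
        rintro rfl
        exact hCS hDS
    have hviol : ((violSets W T C).card : ℝ) ≤ (1 / 2) ^ C.card * (satSets W T).card := by
      calc ((violSets W T C).card : ℝ)
          = (1 / 2) ^ C.card * (2 ^ C.card * (violSets W T C).card) := by
            rw [← mul_assoc, ← mul_pow]; norm_num
        _ ≤ _ := by gcongr
    have hmono : ((violSets W S C).card : ℝ) ≤ (violSets W T C).card := by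
      exact_mod_cast Finset.card_le_card (violSets_anti W hTS C)
    have hunion : ((satSets W T).card : ℝ) ≤
        (satSets W S).card + ∑ D ∈ R, ((violSets W T D).card : ℝ) := by
      have h := card_satSets_le W T R
      rw [Finset.sdiff_union_inter] at h
      exact_mod_cast h
    have hR : ∑ D ∈ R, ((violSets W T D).card : ℝ) ≤ 1 / 2 * (satSets W T).card := by
      calc ∑ D ∈ R, ((violSets W T D).card : ℝ)
          ≤ ∑ D ∈ R, 2 * (1 / 2) ^ D.card * ((satSets W T).card : ℝ) := by
            refine Finset.sum_le_sum fun D hD => ?_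
            obtain ⟨hDS, hDG⟩ := Finset.mem_inter.1 hD
            have hDT : D ∉ T := fun h => (Finset.mem_sdiff.1 h).2 hDG
            exact ih T ⟨hTS, fun h => hDT (h hDS)⟩ (hTS.trans hS) D (hS hDS) hDT
        _ = 2 * (∑ D ∈ R, (1 / 2 : ℝ) ^ D.card) * (satSets W T).card := by
            rw [Finset.mul_sum, Finset.sum_mul]
        _ ≤ 2 * (1 / 4) * (satSets W T).card := by
            gcongr
            exact (Finset.sum_le_sum_of_subset_of_nonneg Finset.inter_subset_right
              fun _ _ _ => by positivity).trans (hsum C hC)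
        _ = 1 / 2 * (satSets W T).card := by norm_num
    calc ((violSets W S C).card : ℝ) ≤ (1 / 2) ^ C.card * (satSets W T).card := hmono.trans hviol
      _ ≤ (1 / 2) ^ C.card * (2 * (satSets W S).card) := by
          gcongr
          linarith
      _ = _ := by ring

/-- A form of the Lovász local lemma for satisfiability. -/
theorem not_unsat_of_sum_Gamma_le (F : CNF V) (hproper : ∀ C ∈ F, ProperClause C)
    (hcard : ∀ C ∈ F, 2 ≤ C.card)
    (hsum : ∀ C ∈ F, ∑ D ∈ Gamma F C, (1 / 2 : ℝ) ^ D.card ≤ 1 / 4) : ¬ Unsat F := by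
  have hpos : ∀ S ⊆ F, 0 < (satSets (F.biUnion vbl) S).card := by
    intro S
    induction S using Finset.induction_on with
    | empty => exact fun _ => Finset.card_pos.2 ⟨∅, by simp [satSets]⟩
    | insert C S hCS ih =>
      intro h
      obtain ⟨hC, hS⟩ := Finset.insert_subset_iff.1 h
      have h1 := card_violSets_le F hproper hsum S hS C hC hCS
      have h2 := card_satSets_le (F.biUnion vbl) S {C}
      rw [Finset.union_comm, ← Finset.insert_eq, Finset.sum_singleton] at h2
      have h2' : ((satSets (F.biUnion vbl) S).card : ℝ) ≤
          (satSets (F.biUnion vbl) (insert C S)).card + (violSets (F.biUnion vbl) S C).card := by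
        exact_mod_cast h2
      have h3 : (0 : ℝ) < (satSets (F.biUnion vbl) S).card := by exact_mod_cast ih hS
      have h4 : (1 / 2 : ℝ) ^ C.card ≤ (1 / 2) ^ 2 :=
        pow_le_pow_of_le_one (by norm_num) (by norm_num) (hcard C hC)
      have h5 : (0 : ℝ) < (satSets (F.biUnion vbl) (insert C S)).card := by nlinarith
      exact_mod_cast h5
  obtain ⟨A, hA⟩ := Finset.card_pos.1 (hpos F subset_rfl)
  exact fun hF => hF _ (Finset.mem_filter.1 hA).2

end LocalLemma

theorem card_Gamma'_le {V : Type} [DecidableEq V] (k : ℕ) (F : CNF V) (C : Clause V)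
    (hC : C ∈ F) : (Gamma' k F C).card ≤ C.card * degCNF k F := by
  have hsub : Gamma' k F C ⊆
      (vbl C).biUnion fun x => F.filter fun D => x ∈ vbl D ∧ D.card ≤ k - 1 := by
    intro D hD
    simp only [Gamma', Gamma, Finset.mem_filter] at hD
    obtain ⟨⟨hDF, -, x, hx⟩, hDk⟩ := hD
    obtain ⟨hxD, hxC⟩ := Finset.mem_inter.1 hx
    exact Finset.mem_biUnion.2 ⟨x, hxC, Finset.mem_filter.2 ⟨hDF, hxD, hDk⟩⟩
  calc (Gamma' k F C).card ≤ _ := Finset.card_le_card hsub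
    _ ≤ (vbl C).card * degCNF k F := Finset.card_biUnion_le_card_mul _ _ _ fun x hx =>
        Finset.le_sup (f := degVar k F) (Finset.mem_biUnion.2 ⟨C, hC, hx⟩)
    _ ≤ C.card * degCNF k F := Nat.mul_le_mul_right _ Finset.card_image_le

theorem sum_Gamma_le {V : Type} [DecidableEq V] (k l : ℕ) (F : CNF V)
    (hbounds : ∀ C ∈ F, l ≤ C.card ∧ C.card ≤ k) (C : Clause V) :
    ∑ D ∈ Gamma F C, (1 / 2 : ℝ) ^ D.card ≤
      (Gamma F C).card * (1 / 2) ^ k + (Gamma' k F C).card * (1 / 2) ^ l := by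
  calc ∑ D ∈ Gamma F C, (1 / 2 : ℝ) ^ D.card
      ≤ ∑ D ∈ Gamma F C, ((1 / 2 : ℝ) ^ k + if D.card ≤ k - 1 then (1 / 2 : ℝ) ^ l else 0) := by
        refine Finset.sum_le_sum fun D hD => ?_
        obtain ⟨h1, h2⟩ := hbounds D (Finset.mem_filter.1 hD).1
        split_ifs with h
        · have := pow_le_pow_of_le_one (by norm_num : (0 : ℝ) ≤ 1 / 2) (by norm_num) h1
          have : (0 : ℝ) < (1 / 2) ^ k := by positivity
          linarith
        · rw [show D.card = k by omega, add_zero]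
    _ = _ := by
        rw [Finset.sum_add_distrib, ← Finset.sum_filter]
        simp [Gamma']

/-- Fix `k` and let `F` be an unsatisfiable `[l,k]`-CNF formula with
`2 ≤ l ≤ k`. Then `F` contains a clause `C` with
`|Γ(C)| > 2^{k-2} - k·d(F)·2^{k-l}`. -/
theorem unsat_has_large_neighborhood (k l : ℕ) (hl : 2 ≤ l) (hlk : l ≤ k)
    (V : Type) [DecidableEq V] (F : CNF V)
    (hproper : ∀ C ∈ F, ProperClause C)
    (hbounds : ∀ C ∈ F, l ≤ C.card ∧ C.card ≤ k)
    (hunsat : Unsat F) :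
    ∃ C ∈ F, (2 : ℝ) ^ (k - 2) - (k : ℝ) * degCNF k F * 2 ^ (k - l) <
      ((Gamma F C).card : ℝ) := by
  by_contra! hcon
  refine not_unsat_of_sum_Gamma_le F hproper (fun C hC => hl.trans (hbounds C hC).1)
    (fun C hC => ?_) hunsat
  have hG' : ((Gamma' k F C).card : ℝ) ≤ k * degCNF k F := by
    exact_mod_cast (card_Gamma'_le k F C hC).trans (Nat.mul_le_mul_right _ (hbounds C hC).2)
  have hpow : ∀ m ≤ k, (2 : ℝ) ^ (k - m) * (1 / 2) ^ k = (1 / 2) ^ m := by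
    intro m hm
    conv_lhs => rw [← Nat.sub_add_cancel hm, Nat.add_sub_cancel, pow_add, ← mul_assoc, ← mul_pow]
    norm_num
  calc ∑ D ∈ Gamma F C, (1 / 2 : ℝ) ^ D.card
      ≤ (Gamma F C).card * (1 / 2) ^ k + (Gamma' k F C).card * (1 / 2) ^ l :=
        sum_Gamma_le k l F hbounds C
    _ ≤ (2 ^ (k - 2) - k * degCNF k F * 2 ^ (k - l)) * (1 / 2) ^ k +
          k * degCNF k F * (1 / 2) ^ l := by
        gcongr
        exact hcon C hC
    _ = 2 ^ (k - 2) * (1 / 2) ^ k := by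
        rw [← hpow l hlk]
        ring
    _ = 1 / 4 := by
        rw [hpow 2 (hl.trans hlk)]
        norm_num
end
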